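/- Let m ≥ 1, n = 2m + 2, and let Q : ℝⁿ → ℝ be a 2m-homogeneous polynomial with Q(ξ) > 0 for all ξ ≠ 0. Define G(y) = ∫_{{ξ ∈ S^{n−1} : ⟨y,ξ⟩ > 0}} log(⟨y,ξ⟩)/Q(ξ) dH^{n−1}(ξ) for y ≠ 0. Then for every y ∈ ℝⁿ\{0}: ΔG(y) = ((n−2)/2)(1/|y|²) ∫_{S^{n−1}} (1/Q(ξ)) dH^{n−1}(ξ) + (1/|y|²) ∫_{{ξ ∈ S^{n−1} : ⟨y,ξ⟩ > 0}} log(⟨ξ, y/|y|⟩) · [ (4m+4−n)⟨ξ, y/|y|⟩ · D¹(1/Q)(ξ)[y/|y|] + 2m/Q(ξ) + D²(1/Q)(ξ)[(y/|y|)^{⊗2}] + ⟨ξ, y/|y|⟩² Δ(1/Q)(ξ) ] dH^{n−1}(ξ). -/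

import Mathlib

open MeasureTheory RealInnerProductSpace

noncomputable section

/-- ℝⁿ as a Euclidean space. -/
abbrev En (n : ℕ) : Type := EuclideanSpace ℝ (Fin n)

/-- The `i`-th standard basis vector of ℝⁿ. -/
def stdB (n : ℕ) (i : Fin n) : En n := EuclideanSpace.single i 1

/-- The symbol Q(ξ) = Σ_{i₁,…,i_{2m}} A_{i₁…i_{2m}} ξ_{i₁}⋯ξ_{i_{2m}}. -/
def symbolQ (n m : ℕ) (A : (Fin (2*m) → Fin n) → ℝ) (ξ : En n) : ℝ :=
  ∑ i : Fin (2*m) → Fin n, A i * ∏ j, ξ (i j)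

/-- The constant-coefficient operator
(Lψ)(x) = (−1)^m Σ A_{i₁…i_{2m}} ∂_{i₁}⋯∂_{i_{2m}} ψ(x). -/
def opL (n m : ℕ) (A : (Fin (2*m) → Fin n) → ℝ) (ψ : En n → ℝ) (x : En n) : ℝ :=
  (-1 : ℝ)^m * ∑ i : Fin (2*m) → Fin n,
    A i * iteratedFDeriv ℝ (2*m) ψ x (fun j => stdB n (i j))

/-- K is a fundamental solution of L: ∫ K(y) (Lψ)(y) dy = ψ(0) for all ψ ∈ C_c^∞. -/
def IsFundamentalSolution (n m : ℕ) (A : (Fin (2*m) → Fin n) → ℝ) (K : En n → ℝ) : Prop :=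
  ∀ ψ : En n → ℝ, ContDiff ℝ (⊤ : ℕ∞) ψ → HasCompactSupport ψ →
    ∫ y, K y * opL n m A ψ y = ψ 0

/-- K is homogeneous of degree a: K(σx) = |σ|^a K(x) for σ ≠ 0, x ≠ 0. -/
def HomogeneousDeg (n : ℕ) (a : ℝ) (K : En n → ℝ) : Prop :=
  ∀ σ : ℝ, σ ≠ 0 → ∀ x : En n, x ≠ 0 → K (σ • x) = |σ| ^ a * K x

/-- The Euclidean Laplacian Δf(x) = Σ_i ∂²f/∂x_i²(x). -/
def lap (n : ℕ) (f : En n → ℝ) (x : En n) : ℝ :=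
  ∑ i : Fin n, iteratedFDeriv ℝ 2 f x (fun _ => stdB n i)

/-- The point (x′, t) ∈ ℝ^{d} × ℝ = ℝ^{d+1}. -/
def snocVec (d : ℕ) (x' : En d) (t : ℝ) : En (d+1) :=
  (EuclideanSpace.equiv (Fin (d+1)) ℝ).symm (Fin.snoc (fun i => x' i) t)


open Set Filter Topology

lemma aux_sphere_finite (k : ℕ) :
    (μH[(k:ℝ)] : Measure (En (k+1))) {ξ : En (k+1) | ‖ξ‖ = 1} < ⊤ := by
  let u : Fin (k+1) → ℝ → (Fin k → ℝ) → En (k+1) := fun i s x =>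
    WithLp.toLp 2 (Fin.insertNth i s x)
  let φ : Fin (k+1) → ℝ → (Fin k → ℝ) → En (k+1) := fun i s x => ‖u i s x‖⁻¹ • u i s x
  let K : Set (Fin k → ℝ) := Metric.closedBall 0 1
  have hK : IsCompact K := isCompact_closedBall _ _
  have hu : ∀ i s, ContDiff ℝ 1 (u i s) := by
    intro i s
    rw [contDiff_euclidean]
    intro j
    refine Fin.succAboveCases i ?_ ?_ j
    · simp only [u, Fin.insertNth_apply_same]; exact contDiff_const
    · intro j; simp only [u, Fin.insertNth_apply_succAbove]; exact contDiff_apply ℝ ℝ j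
  have hu0 : ∀ i s x, s ≠ 0 → u i s x ≠ 0 := by
    intro i s x hs h
    have : u i s x i = 0 := by rw [h]; rfl
    simp [u] at this
    exact hs this
  have hφ : ∀ i s, s ≠ 0 → ∀ x, ContDiffAt ℝ 1 (φ i s) x := by
    intro i s hs x
    have h1 := (hu i s).contDiffAt (x := x)
    exact ((h1.norm ℝ (hu0 i s x hs)).inv (norm_ne_zero_iff.2 (hu0 i s x hs))).smul h1
  have hfin : ∀ i s, s ≠ 0 → (μH[(k:ℝ)] : Measure (En (k+1))) (φ i s '' K) < ⊤ := by
    intro i s hs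
    refine hK.induction_on (p := fun A => (μH[(k:ℝ)] : Measure (En (k+1))) (φ i s '' A) < ⊤)
      (by simp) ?_ ?_ ?_
    · intro A B hAB h
      exact lt_of_le_of_lt (measure_mono (image_mono hAB)) h
    · intro A B hA hB
      rw [image_union]
      exact measure_union_lt_top hA hB
    · intro x _
      obtain ⟨C, t, ht, hL⟩ := (hφ i s hs x).exists_lipschitzOnWith
      refine ⟨t ∩ Metric.ball x 1, mem_nhdsWithin_of_mem_nhds
        (inter_mem ht (Metric.ball_mem_nhds _ one_pos)), ?_⟩
      have h2 := (hL.mono (inter_subset_left (t := Metric.ball x 1))).hausdorffMeasure_image_le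
        (d := (k:ℝ)) (by positivity)
      refine lt_of_le_of_lt h2 ?_
      have h3 : (μH[(k:ℝ)] : Measure (Fin k → ℝ)) = volume := by
        have := hausdorffMeasure_pi_real (ι := Fin k)
        simpa using this
      rw [h3]
      refine ENNReal.mul_lt_top (ENNReal.rpow_lt_top_of_nonneg (by positivity) (by simp)) ?_
      exact lt_of_le_of_lt (measure_mono inter_subset_right) Metric.isBounded_ball.measure_lt_top
  have hsub : {ξ : En (k+1) | ‖ξ‖ = 1} ⊆ ⋃ i : Fin (k+1), (φ i 1 '' K ∪ φ i (-1) '' K) := by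
    intro ξ hξ
    have hξ : ‖ξ‖ = 1 := hξ
    obtain ⟨i, -, hi⟩ := Finset.exists_max_image (Finset.univ : Finset (Fin (k+1)))
      (fun i => |ξ i|) ⟨0, Finset.mem_univ _⟩
    have hi0 : ξ i ≠ 0 := by
      intro h0
      have : ξ = 0 := by
        ext j
        have := hi j (Finset.mem_univ _)
        rw [h0, abs_zero] at this
        simpa using this
      rw [this] at hξ; simp at hξ
    have hpos : 0 < |ξ i| := abs_pos.2 hi0
    let x : Fin k → ℝ := fun j => |ξ i|⁻¹ * ξ (i.succAbove j)
    have hx : x ∈ K := by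
      simp only [K, mem_closedBall_zero_iff]
      rw [pi_norm_le_iff_of_nonneg zero_le_one]
      intro j
      simp only [x, norm_mul, norm_inv, Real.norm_eq_abs, abs_abs]
      rw [inv_mul_le_one₀ hpos]
      exact hi _ (Finset.mem_univ _)
    have hux : u i (|ξ i|⁻¹ * ξ i) x = |ξ i|⁻¹ • ξ := by
      ext j
      refine Fin.succAboveCases i ?_ ?_ j
      · simp [u]
      · intro j; simp [u, x]
    have hφx : φ i (|ξ i|⁻¹ * ξ i) x = ξ := by
      simp only [φ, hux, norm_smul, hξ, norm_inv, Real.norm_eq_abs, abs_abs]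
      rw [smul_smul]
      simp [hpos.ne']
    refine mem_iUnion.2 ⟨i, ?_⟩
    rcases lt_or_gt_of_ne hi0 with h | h
    · right
      refine ⟨x, hx, ?_⟩
      rw [← hφx]
      congr 1
      rw [abs_of_neg h]; field_simp
    · left
      refine ⟨x, hx, ?_⟩
      rw [← hφx]
      congr 1
      rw [abs_of_pos h]; field_simp
  refine lt_of_le_of_lt (measure_mono hsub) ?_
  refine lt_of_le_of_lt (measure_iUnion_fintype_le _ _) ?_
  refine ENNReal.sum_lt_top.2 fun i _ => ?_
  exact measure_union_lt_top (hfin i 1 one_ne_zero) (hfin i (-1) (by norm_num))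

def qq (t : ℝ) : ENNReal := (ENNReal.ofReal |t|) ^ (-(1/2) : ℝ)

lemma qq_meas : Measurable qq := by
  unfold qq; fun_prop

lemma qq_int : ∫⁻ t in Icc (-1:ℝ) 1, qq t < ⊤ := by
  have h1 : IntegrableOn (fun x : ℝ => x ^ (-(1/2) : ℝ)) (Ioc 0 1) := by
    have := intervalIntegral.intervalIntegrable_rpow' (a := 0) (b := 1) (r := -(1/2)) (by norm_num)
    rwa [intervalIntegrable_iff_integrableOn_Ioc_of_le zero_le_one] at this
  have h2 : ∫⁻ t in Ioc (0:ℝ) 1, qq t < ⊤ := by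
    have h3 := h1.2
    unfold HasFiniteIntegral at h3
    refine lt_of_le_of_lt (le_of_eq ?_) h3
    refine setLIntegral_congr_fun measurableSet_Ioc fun t ht => ?_
    have : 0 < t := ht.1
    simp only [qq]
    rw [abs_of_pos this, ENNReal.ofReal_rpow_of_pos this, Real.enorm_eq_ofReal (by positivity)]
  have h4 : ∫⁻ t in Ico (-1:ℝ) 0, qq t < ⊤ := by
    have := (Measure.measurePreserving_neg (volume : Measure ℝ)).setLIntegral_comp_preimage
      (s := Ioc 0 1) (f := qq) measurableSet_Ioc qq_meas
    rw [← this] at h2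
    convert h2 using 2
    · congr 1; ext x; simp
    · ext x; simp [qq]
  have hsub : Icc (-1:ℝ) 1 ⊆ Ico (-1:ℝ) 0 ∪ ({0} ∪ Ioc 0 1) := by
    intro x hx
    rcases lt_trichotomy x 0 with h | h | h
    · left; exact ⟨hx.1, h⟩
    · right; left; exact h
    · right; right; exact ⟨h, hx.2⟩
  refine lt_of_le_of_lt (lintegral_mono_set hsub) ?_
  refine lt_of_le_of_lt (lintegral_union_le _ _ _) ?_
  refine ENNReal.add_lt_top.2 ⟨h4, ?_⟩
  refine lt_of_le_of_lt (lintegral_union_le _ _ _) ?_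
  refine ENNReal.add_lt_top.2 ⟨?_, h2⟩
  simp

lemma aux_ball (k : ℕ) (e : En (k+1)) (he : ‖e‖ = 1) :
    ∫⁻ y in Metric.ball (0 : En (k+1)) 1, qq ⟪y, e⟫
      = ∫⁻ y in Metric.ball (0 : En (k+1)) 1, qq (y 0) := by
  let b : En (k+1) := EuclideanSpace.single 0 1
  have hb : ‖b‖ = 1 := by simp [b]
  have hr := Submodule.reflection_sub (F := En (k+1)) (v := b) (w := e) (by rw [hb, he])
  set L := (ℝ ∙ (b - e))ᗮ.reflection
  have := L.measurePreserving.setLIntegral_comp_preimage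
      (s := Metric.ball 0 1) (f := fun y => qq ⟪y, e⟫) measurableSet_ball
      (qq_meas.comp (by fun_prop))
  rw [← this]
  have h2 : L ⁻¹' Metric.ball 0 1 = Metric.ball 0 1 := by ext x; simp
  rw [h2]
  congr 1
  ext y
  rw [← hr, L.inner_map_map]
  simp [b, EuclideanSpace.inner_single_right]

lemma aux_ball_fin (k : ℕ) :
    ∫⁻ y in Metric.ball (0 : En (k+1)) 1, qq (y 0) < ⊤ := by
  have h1 := (EuclideanSpace.volume_preserving_symm_measurableEquiv_toLp (Fin (k+1))).setLIntegral_comp_preimage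
    (s := univ.pi fun _ => Icc (-1:ℝ) 1) (f := fun y => qq (y 0))
    (MeasurableSet.univ_pi fun _ => measurableSet_Icc) (qq_meas.comp (measurable_pi_apply _))
  have h2 : Metric.ball (0 : En (k+1)) 1 ⊆
     (MeasurableEquiv.toLp 2 (Fin (k+1) → ℝ)).symm ⁻¹' (univ.pi fun _ => Icc (-1:ℝ) 1) := by
    intro y hy
    simp only [mem_preimage, mem_univ_pi]
    intro i
    have : ‖y i‖ ≤ ‖y‖ := PiLp.norm_apply_le y i
    have h3 : ‖y‖ < 1 := by simpa using hy
    rw [Real.norm_eq_abs] at this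
    exact abs_le.1 (this.trans h3.le)
  refine lt_of_le_of_lt (lintegral_mono_set h2) ?_
  refine lt_of_le_of_lt (le_of_eq h1) ?_
  rw [volume_pi, Measure.restrict_pi_pi]
  have h4 := lintegral_map (μ := Measure.pi fun _ : Fin (k+1) => (volume : Measure ℝ).restrict (Icc (-1) 1))
    (f := qq) (g := Function.eval (0 : Fin (k+1))) qq_meas (measurable_pi_apply _)
  simp only [Function.eval] at h4
  rw [← h4]
  have h5 := Measure.pi_map_eval (μ := fun _ : Fin (k+1) => (volume : Measure ℝ).restrict (Icc (-1) 1)) 0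
  erw [h5]
  rw [lintegral_smul_measure]
  refine ENNReal.mul_lt_top ?_ qq_int
  refine ENNReal.prod_lt_top fun i _ => by simp

lemma aux_sphere_int (k : ℕ) (e : En (k+1)) (he : ‖e‖ = 1) :
    ∫⁻ ξ in {ξ : En (k+1) | ‖ξ‖ = 1}, qq ⟪e, ξ⟫ ∂(μH[(k:ℝ)]) < ⊤ := by
  set S := {ξ : En (k+1) | ‖ξ‖ = 1} with hS
  have hSm : MeasurableSet S := measurableSet_eq_fun (by fun_prop) (by fun_prop)
  have hfin := aux_sphere_finite k
  have : IsFiniteMeasure ((μH[(k:ℝ)] : Measure (En (k+1))).restrict S) :=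
    ⟨by rw [Measure.restrict_apply_univ]; exact hfin⟩
  have hinv : ∀ e' : En (k+1), ‖e'‖ = 1 → ∫⁻ ξ in S, qq ⟪e', ξ⟫ ∂(μH[(k:ℝ)]) =
     ∫⁻ ξ in S, qq ⟪e, ξ⟫ ∂(μH[(k:ℝ)]) := by
    intro e' he'
    have hr := Submodule.reflection_sub (F := En (k+1)) (v := e) (w := e') (by rw [he', he])
    set L := (ℝ ∙ (e - e'))ᗮ.reflection
    have := (L.toIsometryEquiv.measurePreserving_hausdorffMeasure (k:ℝ)).setLIntegral_comp_preimage
      (s := S) (f := fun y => qq ⟪e', y⟫) hSm (qq_meas.comp (by fun_prop))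
    rw [← this]
    have h2 : L.toIsometryEquiv ⁻¹' S = S := by ext x; simp [hS]
    rw [h2]
    congr 1
    ext y
    rw [← hr]
    simp
  have h1 : (∫⁻ ξ in S, qq ⟪e, ξ⟫ ∂(μH[(k:ℝ)])) * volume (Metric.ball (0 : En (k+1)) 1) ≤
     ∫⁻ y in Metric.ball (0 : En (k+1)) 1, ∫⁻ ξ in S, qq ⟪y, ξ⟫ ∂(μH[(k:ℝ)]) := by
    rw [← setLIntegral_const]
    refine lintegral_mono_ae ?_
    have hne : ∀ᵐ y ∂((volume : Measure (En (k+1))).restrict (Metric.ball (0 : En (k+1)) 1)), y ≠ 0 :=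
      ae_restrict_of_ae (Measure.ae_ne _ _)
    filter_upwards [hne, ae_restrict_mem measurableSet_ball] with y hy hyb
    have hny : 0 < ‖y‖ := norm_pos_iff.2 hy
    have hyb : ‖y‖ < 1 := by simpa using hyb
    rw [← hinv (‖y‖⁻¹ • y) (by simp [norm_smul, hny.ne'])]
    refine lintegral_mono fun ξ => ?_
    unfold qq
    rw [inner_smul_left, abs_mul]
    rw [ENNReal.rpow_neg, ENNReal.rpow_neg, ENNReal.inv_le_inv]
    refine ENNReal.rpow_le_rpow ?_ (by norm_num)
    refine ENNReal.ofReal_le_ofReal ?_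
    simp only [conj_trivial, abs_inv, abs_norm]
    exact le_mul_of_one_le_left (abs_nonneg _) ((one_le_inv₀ hny).2 hyb.le)
  rw [lintegral_lintegral_swap] at h1
  · have h2 : ∫⁻ ξ in S, ∫⁻ y in Metric.ball (0 : En (k+1)) 1, qq ⟪y, ξ⟫ ∂volume ∂(μH[(k:ℝ)])
      = ∫⁻ ξ in S, (∫⁻ y in Metric.ball (0 : En (k+1)) 1, qq (y 0)) ∂(μH[(k:ℝ)]) :=
      setLIntegral_congr_fun hSm fun ξ hξ => aux_ball k ξ hξ
    rw [h2, setLIntegral_const] at h1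
    have h3 := lt_of_le_of_lt h1 (ENNReal.mul_lt_top (aux_ball_fin k) hfin)
    refine lt_top_iff_ne_top.2 fun h => ?_
    rw [h, ENNReal.top_mul] at h3
    · simp at h3
    · exact (Metric.measure_ball_pos _ _ one_pos).ne'
  · exact (qq_meas.comp (by fun_prop)).aemeasurable

lemma aux_equator (k : ℕ) (e : En (k+1)) (he : ‖e‖ = 1) :
    ∀ᵐ ξ ∂((μH[(k:ℝ)] : Measure (En (k+1))).restrict {ξ : En (k+1) | ‖ξ‖ = 1}), ⟪e, ξ⟫ ≠ 0 := by
  have h := ae_lt_top (qq_meas.comp (by fun_prop)) (aux_sphere_int k e he).ne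
  filter_upwards [h] with ξ hξ h0
  simp [qq, h0] at hξ

lemma aux_log (k : ℕ) (e : En (k+1)) (he : ‖e‖ = 1) :
    IntegrableOn (fun ξ : En (k+1) => Real.log ⟪e, ξ⟫) {ξ : En (k+1) | ‖ξ‖ = 1} (μH[(k:ℝ)]) := by
  have hSm : MeasurableSet {ξ : En (k+1) | ‖ξ‖ = 1} :=
    measurableSet_eq_fun (by fun_prop) (by fun_prop)
  refine ⟨(Real.measurable_log.comp (by fun_prop)).aestronglyMeasurable, ?_⟩
  refine lt_of_le_of_lt (lintegral_mono_ae ?_)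
    (lt_of_eq_of_lt (lintegral_const_mul (ENNReal.ofReal 2) (qq_meas.comp (by fun_prop)))
      (ENNReal.mul_lt_top (by simp) (aux_sphere_int k e he)))
  filter_upwards [aux_equator k e he, ae_restrict_mem hSm] with ξ hξ hξ1
  have hpos : 0 < |⟪e, ξ⟫| := abs_pos.2 hξ
  have hle : |⟪e, ξ⟫| ≤ 1 := by
    have := abs_real_inner_le_norm e ξ
    rwa [he, hξ1, one_mul] at this
  simp only [Function.comp, qq]
  rw [ENNReal.ofReal_rpow_of_pos hpos, ← ENNReal.ofReal_mul (by norm_num), ← ofReal_norm]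
  refine ENNReal.ofReal_le_ofReal ?_
  rw [Real.norm_eq_abs, ← Real.log_abs, abs_of_nonpos (Real.log_nonpos hpos.le hle)]
  have := Real.log_le_rpow_div (x := |⟪e, ξ⟫|⁻¹) (ε := 1/2) (by positivity) (by norm_num)
  rw [Real.log_inv, Real.inv_rpow hpos.le, ← Real.rpow_neg hpos.le] at this
  linarith

open scoped ContDiff

lemma aux_param_smooth {n : ℕ} {F : Type} [NormedAddCommGroup F] [NormedSpace ℝ F]
    (Φ : En n → En n → F) (p : En n × En n)
    (h : ContDiffAt ℝ ∞ (Function.uncurry Φ) p) :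
    ContDiffAt ℝ ∞ (Function.uncurry fun y ξ => fderiv ℝ (fun z => Φ z ξ) y) p := by
  have := ContDiffAt.fderiv (𝕜 := ℝ) (x₀ := p) (m := ∞) (n := ∞)
    (f := fun (q : En n × En n) z => Φ z q.2) (g := Prod.fst) ?_ contDiffAt_fst (by simp)
  · exact this
  · have h2 : ContDiffAt ℝ ∞ (fun q : (En n × En n) × En n => (q.2, q.1.2)) (p, p.1) := by fun_prop
    exact ContDiffAt.comp (p, p.1) (g := Function.uncurry Φ) (by simpa using h) h2

lemma aux_param {n : ℕ} {F : Type} [NormedAddCommGroup F] [NormedSpace ℝ F] (μ : Measure (En n))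
    (K K' : Set (En n)) (hK : IsCompact K) (hK' : MeasurableSet K') (hKK : K' ⊆ K)
    (U : Set (En n)) (hU : IsOpen U) (Φ : En n → En n → F)
    (hΦ : ∀ y ∈ U, ∀ ξ ∈ K, ContDiffAt ℝ ∞ (Function.uncurry Φ) (y, ξ))
    (g : En n → ℝ) (hg : IntegrableOn g K' μ) (y : En n) (hy : y ∈ U) :
    (∀ y ∈ U, Integrable (fun ξ => g ξ • Φ y ξ) (μ.restrict K')) ∧
    HasFDerivAt (fun y => ∫ ξ in K', g ξ • Φ y ξ ∂μ)
      (∫ ξ in K', g ξ • fderiv ℝ (fun z => Φ z ξ) y ∂μ) y := by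
  have hcont : ∀ {G : Type} [NormedAddCommGroup G] [NormedSpace ℝ G] (Ψ : En n → En n → G),
      (∀ y ∈ U, ∀ ξ ∈ K, ContDiffAt ℝ ∞ (Function.uncurry Ψ) (y, ξ)) → ∀ y ∈ U,
      ContinuousOn (Ψ y) K := by
    intro G _ _ Ψ hΨ y hy ξ hξ
    have h1 := (hΨ y hy ξ hξ).continuousAt
    have h2 : ContinuousAt (fun ξ : En n => (y, ξ)) ξ := by fun_prop
    exact (ContinuousAt.comp (f := fun ξ : En n => (y, ξ)) h1 h2).continuousWithinAt
  have hmeas : ∀ {G : Type} [NormedAddCommGroup G] [NormedSpace ℝ G] (Ψ : En n → En n → G),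
      (∀ y ∈ U, ∀ ξ ∈ K, ContDiffAt ℝ ∞ (Function.uncurry Ψ) (y, ξ)) → ∀ y ∈ U,
      AEStronglyMeasurable (fun ξ => g ξ • Ψ y ξ) (μ.restrict K') := by
    intro G _ _ Ψ hΨ y hy
    refine hg.1.smul ?_
    exact ((hcont Ψ hΨ y hy).aestronglyMeasurable_of_isCompact hK hK.measurableSet).mono_measure
      (Measure.restrict_mono hKK le_rfl)
  have hΦ' : ∀ y ∈ U, ∀ ξ ∈ K, ContDiffAt ℝ ∞
      (Function.uncurry fun y ξ => fderiv ℝ (fun z => Φ z ξ) y) (y, ξ) :=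
    fun y hy ξ hξ => aux_param_smooth Φ _ (hΦ y hy ξ hξ)
  have hint : ∀ y ∈ U, Integrable (fun ξ => g ξ • Φ y ξ) (μ.restrict K') := by
    intro y hy
    obtain ⟨C, hC⟩ := hK.exists_bound_of_continuousOn (hcont Φ hΦ y hy)
    refine Integrable.mono' (hg.norm.mul_const C) (hmeas Φ hΦ y hy) ?_
    filter_upwards [ae_restrict_mem hK'] with ξ hξ
    rw [norm_smul]
    exact mul_le_mul_of_nonneg_left (hC ξ (hKK hξ)) (norm_nonneg _)
  refine ⟨hint, ?_⟩
  obtain ⟨ε, hε, hB⟩ := Metric.nhds_basis_closedBall.mem_iff.1 (hU.mem_nhds hy)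
  have hcB : IsCompact (Metric.closedBall y ε ×ˢ K) := (isCompact_closedBall y ε).prod hK
  obtain ⟨C, hC⟩ := hcB.exists_bound_of_continuousOn
    (f := Function.uncurry fun y ξ => fderiv ℝ (fun z => Φ z ξ) y) (by
      rintro ⟨z, ξ⟩ ⟨hz, hξ⟩
      exact (hΦ' z (hB hz) ξ hξ).continuousAt.continuousWithinAt)
  refine hasFDerivAt_integral_of_dominated_of_fderiv_le (bound := fun ξ => ‖g ξ‖ * C)
    (F' := fun y ξ => g ξ • fderiv ℝ (fun z => Φ z ξ) y)
    (Metric.closedBall_mem_nhds y hε) ?_ (hint y hy)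
    (hmeas _ hΦ' y hy) ?_ (hg.norm.mul_const C) ?_
  · filter_upwards [hU.mem_nhds hy] with z hz using hmeas Φ hΦ z hz
  · filter_upwards [ae_restrict_mem hK'] with ξ hξ z hz
    rw [norm_smul]
    exact mul_le_mul_of_nonneg_left (hC (z, ξ) ⟨hz, hKK hξ⟩) (norm_nonneg _)
  · filter_upwards [ae_restrict_mem hK'] with ξ hξ z hz
    have h1 := hΦ z (hB hz) ξ (hKK hξ)
    have h2 : ContDiffAt ℝ ∞ (fun z : En n => (z, ξ)) z := by fun_prop
    have h3 : ContDiffAt ℝ ∞ (fun z => Φ z ξ) z :=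
      ContDiffAt.comp z (f := fun z : En n => (z, ξ)) h1 h2
    exact (h3.differentiableAt (by simp)).hasFDerivAt.const_smul (g ξ)

lemma aux_curve {n : ℕ} (F : En n → ℝ) (γ γ' : ℝ → En n) (γ'' : En n)
    (hF : ContDiffAt ℝ 2 F (γ 0)) (h1 : ∀ᶠ s in 𝓝 (0:ℝ), HasDerivAt γ (γ' s) s)
    (h2 : HasDerivAt γ' γ'' 0) :
    deriv (deriv (fun s => F (γ s))) 0 =
      fderiv ℝ (fderiv ℝ F) (γ 0) (γ' 0) (γ' 0) + fderiv ℝ F (γ 0) γ'' := by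
  have hγ := h1.self_of_nhds
  have hd : ∀ᶠ s in 𝓝 (0:ℝ), DifferentiableAt ℝ F (γ s) := by
    have := hγ.continuousAt.eventually (hF.eventually (by simp))
    filter_upwards [this] with s hs using hs.differentiableAt (by simp)
  have he : deriv (fun s => F (γ s)) =ᶠ[𝓝 0] fun s => fderiv ℝ F (γ s) (γ' s) := by
    filter_upwards [h1, hd] with s hs hs2
    exact (hs2.hasFDerivAt.comp_hasDerivAt s hs).deriv
  rw [he.deriv_eq]
  have h3 : DifferentiableAt ℝ (fderiv ℝ F) (γ 0) :=
    (hF.fderiv_right (m := 1) (by norm_num)).differentiableAt (by simp)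
  have h4 := (h3.hasFDerivAt.comp_hasDerivAt 0 hγ).clm_apply h2
  exact h4.deriv

lemma lap_eq {n : ℕ} (f : En n → ℝ) (x : En n) (b : OrthonormalBasis (Fin n) ℝ (En n)) :
    lap n f x = ∑ i, fderiv ℝ (fderiv ℝ f) x (b i) (b i) := by
  have h1 := InnerProductSpace.laplacian_eq_iteratedFDeriv_orthonormalBasis f
    (EuclideanSpace.basisFun (Fin n) ℝ)
  have h2 := InnerProductSpace.laplacian_eq_iteratedFDeriv_orthonormalBasis f b
  have h3 := congrFun (h1.symm.trans h2) x
  simp only [iteratedFDeriv_two_apply] at h3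
  simp only [lap, iteratedFDeriv_two_apply]
  simpa [stdB] using h3

def wv {n : ℕ} (e y : En n) : En n := ‖y‖ • e + y

def rotL {n : ℕ} (e y : En n) : En n ≃ₗᵢ[ℝ] En n :=
  (ℝ ∙ e).reflection.trans (ℝ ∙ (wv e y)).reflection

lemma rotL_apply {n : ℕ} (e y x : En n) (he : ‖e‖ = 1) : rotL e y x =
    (2 * (⟪wv e y, (2 * ⟪e, x⟫) • e - x⟫ / ‖wv e y‖^2)) • wv e y - ((2 * ⟪e, x⟫) • e - x) := by
  simp only [rotL, LinearIsometryEquiv.trans_apply, Submodule.reflection_singleton_apply, he]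
  simp only [RCLike.ofReal_real_eq_id, id, one_pow, div_one]
  simp only [← Nat.cast_smul_eq_nsmul ℝ, smul_smul, Nat.cast_ofNat]

lemma wv_norm {n : ℕ} (e y : En n) (he : ‖e‖ = 1) :
    ‖wv e y‖^2 = 2 * ‖y‖ * ⟪wv e y, e⟫ := by
  rw [← real_inner_self_eq_norm_sq]
  simp only [wv, inner_add_left, inner_add_right, inner_smul_left, inner_smul_right,
    real_inner_self_eq_norm_sq, he, conj_trivial, real_inner_comm e y]
  ring

lemma rotL_e {n : ℕ} (e y : En n) (he : ‖e‖ = 1) (hy : y ≠ 0) (hw : wv e y ≠ 0) :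
    rotL e y e = ‖y‖⁻¹ • y := by
  rw [rotL_apply e y e he, real_inner_self_eq_norm_sq, he]
  have h1 : ((2:ℝ) * 1 ^ 2) • e - e = e := by rw [one_pow, mul_one, two_smul]; abel
  rw [h1]
  have hy' : ‖y‖ ≠ 0 := norm_ne_zero_iff.2 hy
  have hw' : ‖wv e y‖ ^ 2 ≠ 0 := pow_ne_zero _ (norm_ne_zero_iff.2 hw)
  have h2 : 2 * (⟪wv e y, e⟫ / ‖wv e y‖^2) = ‖y‖⁻¹ := by
    have := wv_norm e y he
    field_simp
    rw [this]; ring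
  rw [h2, wv, smul_add, smul_smul, inv_mul_cancel₀ hy', one_smul]
  abel

lemma rotL_inner {n : ℕ} (e y : En n) (he : ‖e‖ = 1) (hy : y ≠ 0) (hw : wv e y ≠ 0) (η : En n) :
    ⟪y, rotL e y η⟫ = ‖y‖ * ⟪e, η⟫ := by
  have h := (rotL e y).inner_map_map e η
  rw [rotL_e e y he hy hw, inner_smul_left] at h
  rw [← h]
  have hy' : ‖y‖ ≠ 0 := norm_ne_zero_iff.2 hy
  simp [hy']

lemma rotL_smooth {n : ℕ} (e : En n) (he : ‖e‖ = 1) (f : En n → ℝ)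
    (hf : ∀ z, z ≠ 0 → ContDiffAt ℝ ∞ f z) (y ξ : En n) (hy : y ≠ 0) (hw : wv e y ≠ 0)
    (hξ : ξ ≠ 0) :
    ContDiffAt ℝ ∞ (Function.uncurry fun y ξ => f (rotL e y ξ)) (y, ξ) := by
  have h0 : ContDiffAt ℝ ∞ (fun p : En n × En n => ‖p.1‖) (y, ξ) :=
    ContDiffAt.norm ℝ contDiffAt_fst hy
  have h1 : ContDiffAt ℝ ∞ (fun p : En n × En n => wv e p.1) (y, ξ) := by
    unfold wv
    exact (h0.smul contDiffAt_const).add contDiffAt_fst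
  have h2 : ContDiffAt ℝ ∞ (fun p : En n × En n => (2 * ⟪e, p.2⟫) • e - p.2) (y, ξ) :=
    ((contDiffAt_const.mul (contDiffAt_const.inner ℝ contDiffAt_snd)).smul contDiffAt_const).sub
      contDiffAt_snd
  have h3 : ContDiffAt ℝ ∞ (fun p : En n × En n => rotL e p.1 p.2) (y, ξ) := by
    simp only [rotL_apply _ _ _ he]
    refine ((contDiffAt_const.mul ((h1.inner ℝ h2).div (h1.norm_sq ℝ) ?_)).smul h1).sub h2
    exact pow_ne_zero _ (norm_ne_zero_iff.2 hw)
  refine ContDiffAt.comp (y, ξ) (g := f) (f := fun p : En n × En n => rotL e p.1 p.2) (hf _ ?_) h3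
  simpa using hξ

lemma aux_N (r : ℝ) (hr : 0 < r) (s : ℝ) :
    HasDerivAt (fun s => (√(r^2+s^2))⁻¹) (-(s * ((√(r^2+s^2))⁻¹)^3)) s := by
  have hp : 0 < r^2+s^2 := by positivity
  have h1 : HasDerivAt (fun s => r^2+s^2) (2*s) s := by
    simpa using ((hasDerivAt_id s).pow 2).const_add (r^2)
  have h2 := (h1.sqrt hp.ne').inv (Real.sqrt_pos.2 hp).ne'
  refine h2.congr_deriv ?_
  have : √(r^2+s^2) ≠ 0 := (Real.sqrt_pos.2 hp).ne'
  generalize √(r^2+s^2) = N at *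
  field_simp

lemma rotL_line {n : ℕ} (e v x : En n) (he : ‖e‖ = 1) (hv : ‖v‖ = 1) (hev : ⟪e, v⟫ = 0)
    (r : ℝ) (hr : 0 < r) (s : ℝ) :
    rotL e (r • e + s • v) x = x + (r * (√(r^2+s^2))⁻¹ - 1) • (⟪e,x⟫ • e + ⟪v,x⟫ • v)
      + (s * (√(r^2+s^2))⁻¹) • (⟪e,x⟫ • v - ⟪v,x⟫ • e) := by
  have hp : 0 < r^2+s^2 := by positivity
  have hve : ⟪v, e⟫ = 0 := by rw [real_inner_comm]; exact hev
  have hn : ‖r • e + s • v‖ = √(r^2+s^2) := by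
    rw [← Real.sqrt_sq (norm_nonneg _), ← real_inner_self_eq_norm_sq]
    congr 1
    simp only [inner_add_left, inner_add_right, inner_smul_left, inner_smul_right,
      real_inner_self_eq_norm_sq, he, hv, hev, hve, conj_trivial]
    ring
  set N := √(r^2+s^2) with hN
  have hNp : 0 < N := Real.sqrt_pos.2 hp
  have hN2 : N^2 = r^2+s^2 := Real.sq_sqrt hp.le
  have hw : wv e (r • e + s • v) = (N + r) • e + s • v := by
    rw [wv, hn]; module
  have hwn : ‖wv e (r • e + s • v)‖^2 = 2 * N * (N + r) := by
    rw [wv_norm _ _ he, hn, hw]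
    simp only [inner_add_left, inner_smul_left, real_inner_self_eq_norm_sq, he, hve, conj_trivial]
    ring
  have hwi : ⟪wv e (r • e + s • v), (2 * ⟪e, x⟫) • e - x⟫ = (N + r) * ⟪e,x⟫ - s * ⟪v,x⟫ := by
    rw [hw]
    simp only [inner_add_left, inner_sub_right, inner_smul_left, inner_smul_right,
      real_inner_self_eq_norm_sq, he, hve, conj_trivial]
    ring
  rw [rotL_apply _ _ _ he, hwn, hwi, hw]
  have hNr : N + r ≠ 0 := by positivity
  have hs : s^2 = (N - r) * (N + r) := by linear_combination -hN2
  have c1 : 2 * (((N + r) * ⟪e,x⟫ - s * ⟪v,x⟫) / (2 * N * (N + r))) * (N + r) =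
     ⟪e,x⟫ + r * N⁻¹ * ⟪e,x⟫ - s * N⁻¹ * ⟪v,x⟫ := by
    field_simp
  have c2 : 2 * (((N + r) * ⟪e,x⟫ - s * ⟪v,x⟫) / (2 * N * (N + r))) * s =
     s * N⁻¹ * ⟪e,x⟫ - (1 - r * N⁻¹) * ⟪v,x⟫ := by
    field_simp
    linear_combination (-⟪v,x⟫) * hs
  rw [smul_add, smul_smul, smul_smul, c1, c2]
  module

lemma line_e {n : ℕ} (e x : En n) (he : ‖e‖ = 1) (c : ℝ) (hc : 0 < c) : rotL e (c • e) x = x := by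
  have hw : wv e (c • e) = (2 * c) • e := by
    rw [wv, norm_smul, he, Real.norm_eq_abs, abs_of_pos hc]; module
  rw [rotL_apply _ _ _ he, hw]
  simp only [norm_smul, he, inner_smul_left, inner_sub_right, inner_smul_right,
    real_inner_self_eq_norm_sq, conj_trivial, Real.norm_eq_abs, abs_of_pos hc, smul_smul,
    abs_mul, abs_two]
  have : 2 * ((2 * ⟪e, x⟫ * (2 * c * 1 ^ 2) - 2 * c * ⟪e, x⟫) / (2 * c * 1) ^ 2) * (2 * c) = 2 * ⟪e,x⟫ := by
    field_simp; ring
  rw [this]; abel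

lemma two_le_inf : (2 : WithTop ℕ∞) ≤ ∞ := WithTop.coe_le_coe.2 (le_top : (2:ℕ∞) ≤ ⊤)

lemma one_le_inf : (1 + 1 : WithTop ℕ∞) ≤ ∞ := by rw [one_add_one_eq_two]; exact two_le_inf

lemma second_v {n : ℕ} (e v x : En n) (he : ‖e‖ = 1) (hv : ‖v‖ = 1) (hev : ⟪e, v⟫ = 0)
    (r : ℝ) (hr : 0 < r) (f : En n → ℝ) (hf : ContDiffAt ℝ 2 f x)
    (hΦ : ContDiffAt ℝ 2 (fun y => f (rotL e y x)) (r • e)) :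
    fderiv ℝ (fderiv ℝ (fun y => f (rotL e y x))) (r • e) v v =
      (r^2)⁻¹ * (fderiv ℝ (fderiv ℝ f) x (⟪e,x⟫ • v - ⟪v,x⟫ • e) (⟪e,x⟫ • v - ⟪v,x⟫ • e)
        - fderiv ℝ f x (⟪e,x⟫ • e + ⟪v,x⟫ • v)) := by
  have h1 := aux_curve (fun y => f (rotL e y x)) (fun s : ℝ => r • e + s • v) (fun _ => v) 0
    (by simpa using hΦ) (Eventually.of_forall fun s => by
      simpa using ((hasDerivAt_id s).smul_const v).const_add (r • e)) (hasDerivAt_const _ _)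
  simp only [rotL_line e v x he hv hev r hr] at h1
  set a := ⟪e,x⟫ • e + ⟪v,x⟫ • v with ha
  set b := ⟪e,x⟫ • v - ⟪v,x⟫ • e with hb
  have hM0 : (√(r^2+0^2))⁻¹ = r⁻¹ := by
    rw [zero_pow two_ne_zero, add_zero, Real.sqrt_sq hr.le]
  have hM : ∀ s, HasDerivAt (fun s => x + (r * (√(r^2+s^2))⁻¹ - 1) • a + (s * (√(r^2+s^2))⁻¹) • b)
     ((r * -(s * ((√(r^2+s^2))⁻¹)^3)) • a +
      (1 * (√(r^2+s^2))⁻¹ + s * -(s * ((√(r^2+s^2))⁻¹)^3)) • b) s := by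
    intro s
    have hN := aux_N r hr s
    exact ((((hN.const_mul r).sub_const 1).smul_const a).const_add x).add
      (((hasDerivAt_id s).mul hN).smul_const b)
  have hM2 : HasDerivAt (fun s => (r * -(s * ((√(r^2+s^2))⁻¹)^3)) • a +
      (1 * (√(r^2+s^2))⁻¹ + s * -(s * ((√(r^2+s^2))⁻¹)^3)) • b) (-(r^2)⁻¹ • a) 0 := by
    have hN := aux_N r hr 0
    have h3 := ((hasDerivAt_id (0:ℝ)).mul (hN.pow 3)).neg
    have h4 := ((h3.const_mul r).smul_const a).add
      (((hN.const_mul 1).add ((hasDerivAt_id (0:ℝ)).mul h3)).smul_const b)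
    refine h4.congr_deriv ?_
    simp [Real.sqrt_sq hr.le]
    congr 1
    field_simp
  have h2 := aux_curve f _ _ _ (by simpa [Real.sqrt_sq hr.le, hr.ne'] using hf) (Eventually.of_forall hM) hM2
  rw [h2] at h1
  simp only [hM0, hr.ne', ne_eq, not_false_eq_true, mul_inv_cancel₀, sub_self, zero_smul, zero_mul,
    add_zero, neg_zero, mul_zero, zero_add, one_mul, map_zero, map_smul,
    _root_.smul_apply, smul_eq_mul] at h1
  rw [← h1]
  field_simp
  ring

lemma second_e {n : ℕ} (e x : En n) (he : ‖e‖ = 1)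
    (r : ℝ) (hr : 0 < r) (f : En n → ℝ)
    (hΦ : ContDiffAt ℝ 2 (fun y => f (rotL e y x)) (r • e)) :
    fderiv ℝ (fderiv ℝ (fun y => f (rotL e y x))) (r • e) e e = 0 := by
  have h1 := aux_curve (fun y => f (rotL e y x)) (fun s : ℝ => r • e + s • e) (fun _ => e) 0
    (by simpa using hΦ) (Eventually.of_forall fun s => by
      simpa using ((hasDerivAt_id s).smul_const e).const_add (r • e)) (hasDerivAt_const _ _)
  have h2 : (fun s : ℝ => f (rotL e (r • e + s • e) x)) =ᶠ[𝓝 0] fun _ => f x := by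
    filter_upwards [lt_mem_nhds (show -r < 0 by linarith)] with s hs
    rw [← add_smul, line_e e x he _ (by linarith)]
  have h3 : deriv (fun s : ℝ => f (rotL e (r • e + s • e) x)) =ᶠ[𝓝 0] fun _ => 0 := by
    have := h2.deriv
    simpa using this
  rw [h3.deriv_eq] at h1
  simp at h1
  exact h1.symm

lemma euler1 {n : ℕ} (m : ℕ) (f : En n → ℝ) (hf : ∀ z, z ≠ 0 → ContDiffAt ℝ ∞ f z)
    (hhom : ∀ σ : ℝ, ∀ z, f (σ • z) = (σ^(2*m))⁻¹ * f z) (x : En n) (hx : x ≠ 0) :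
    fderiv ℝ f x x = -(2*m) * f x := by
  have hd := ((hf x hx).differentiableAt (by simp)).hasFDerivAt
  have h1 : HasDerivAt (fun s : ℝ => s • x) ((1:ℝ) • x) 1 := (hasDerivAt_id _).smul_const x
  have h2 : HasDerivAt (fun s : ℝ => f (s • x)) (fderiv ℝ f x ((1:ℝ) • x)) 1 := by
    refine HasFDerivAt.comp_hasDerivAt (x := (1:ℝ)) (l := f) (f := fun s : ℝ => s • x) ?_ h1
    simpa using hd
  simp only [hhom] at h2
  have h3 := (((hasDerivAt_id (1:ℝ)).pow (2*m)).inv (by simp)).mul_const (f x)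
  have h4 := h2.unique h3
  simp at h4
  rw [h4]; ring

lemma euler2 {n : ℕ} (m : ℕ) (f : En n → ℝ) (hf : ∀ z, z ≠ 0 → ContDiffAt ℝ ∞ f z)
    (hhom : ∀ σ : ℝ, ∀ z, f (σ • z) = (σ^(2*m))⁻¹ * f z) (x : En n) (hx : x ≠ 0) (e : En n) :
    fderiv ℝ (fderiv ℝ f) x e x = -(2*m+1) * fderiv ℝ f x e := by
  have h0 : (fun z => fderiv ℝ f z z) =ᶠ[𝓝 x] fun z => -(2*m) * f z := by
    filter_upwards [isOpen_ne.mem_nhds hx] with z hz using euler1 m f hf hhom z hz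
  have hd := ((hf x hx).differentiableAt (by simp)).hasFDerivAt
  have hd2 := (((hf x hx).fderiv_right (m := 1) one_le_inf).differentiableAt (by simp)).hasFDerivAt
  have h1 := (hd2.clm_apply (hasFDerivAt_id x)).congr_of_eventuallyEq h0.symm
  have h2 := h1.unique (hd.const_mul (-(2*m : ℝ)))
  have h3 := congrArg (fun L => L e) h2
  simp at h3
  linarith

lemma lap_point {n : ℕ} (hn : 0 < n) (m : ℕ) (f : En n → ℝ)
    (hf : ∀ z, z ≠ 0 → ContDiffAt ℝ ∞ f z)
    (hhom : ∀ σ : ℝ, ∀ z, f (σ • z) = (σ^(2*m))⁻¹ * f z) (x e : En n) (hx : ‖x‖ = 1)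
    (he : ‖e‖ = 1) (r : ℝ) (hr : 0 < r) (b : OrthonormalBasis (Fin n) ℝ (En n))
    (hb : b ⟨0, hn⟩ = e) :
    ∑ i, fderiv ℝ (fderiv ℝ (fun y => f (rotL e y x))) (r • e) (b i) (b i) =
     (r^2)⁻¹ * (((4*m + 4 : ℝ) - n) * ⟪e, x⟫ * fderiv ℝ f x e + 2 * m * f x
       + fderiv ℝ (fderiv ℝ f) x e e + ⟪e, x⟫^2 * lap n f x) := by
  have hx0 : x ≠ 0 := by rintro rfl; simp at hx
  have hw0 : wv e (r • e) ≠ 0 := by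
    have : wv e (r • e) = (2 * r) • e := by
      rw [wv, norm_smul, he, Real.norm_eq_abs, abs_of_pos hr]; module
    rw [this]
    refine smul_ne_zero (by positivity) ?_
    rintro rfl; simp at he
  have hre : r • e ≠ 0 := smul_ne_zero hr.ne' (by rintro rfl; simp at he)
  have hΦ : ContDiffAt ℝ 2 (fun y => f (rotL e y x)) (r • e) := by
    have h1 := rotL_smooth e he f hf (r • e) x hre hw0 hx0
    have h2 : ContDiffAt ℝ ∞ (fun z : En n => (z, x)) (r • e) := by fun_prop
    have h3 : ContDiffAt ℝ ∞ (fun y => f (rotL e y x)) (r • e) :=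
      ContDiffAt.comp (r • e) (f := fun z : En n => (z, x)) h1 h2
    exact h3.of_le two_le_inf
  have hf2 : ContDiffAt ℝ 2 f x := (hf x hx0).of_le two_le_inf
  set D1 := fderiv ℝ f x with hD1
  set D2 := fderiv ℝ (fderiv ℝ f) x with hD2
  have hsymm : ∀ u v, D2 u v = D2 v u := fun u v =>
    (hf2.isSymmSndFDerivAt (by simp)) u v
  have hterm : ∀ i, fderiv ℝ (fderiv ℝ (fun y => f (rotL e y x))) (r • e) (b i) (b i) =
      (r^2)⁻¹ * (⟪e,x⟫^2 * D2 (b i) (b i) - 2 * ⟪e,x⟫ * (⟪b i,x⟫ * D2 e (b i))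
        + ⟪b i,x⟫^2 * D2 e e - ⟪e,x⟫ * D1 e - ⟪b i,x⟫ * D1 (b i))
      + if i = ⟨0,hn⟩ then (r^2)⁻¹ * (2 * ⟪e,x⟫ * D1 e) else 0 := by
    intro i
    split_ifs with hi
    · rw [hi, hb, second_e e x he r hr f hΦ]
      ring
    · have hv : ‖b i‖ = 1 := b.orthonormal.1 i
      have hev : ⟪e, b i⟫ = 0 := by
        rw [← hb]; exact b.orthonormal.2 (Ne.symm hi)
      rw [second_v e (b i) x he hv hev r hr f hf2 hΦ, ← hD1, ← hD2]
      simp only [map_sub, map_add, map_smul, _root_.sub_apply,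
        _root_.smul_apply, smul_eq_mul]
      rw [hsymm (b i) e]
      ring
  rw [Finset.sum_congr rfl fun i _ => hterm i, Finset.sum_add_distrib, ← Finset.mul_sum]
  simp only [Finset.sum_add_distrib, Finset.sum_sub_distrib, ← Finset.mul_sum,
    ← Finset.sum_mul, Finset.sum_ite_eq', Finset.mem_univ, if_true, Finset.sum_const,
    Finset.card_univ, Fintype.card_fin, nsmul_eq_mul]
  have hsum : ∑ i, ⟪b i, x⟫ • b i = x := b.sum_repr' x
  have s1 : ∑ i, ⟪b i,x⟫ * D1 (b i) = -(2*m) * f x := by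
    rw [← euler1 m f hf hhom x hx0, ← hD1]
    conv_rhs => rw [← hsum]
    simp
  have s2 : ∑ i, ⟪b i,x⟫ * D2 e (b i) = -(2*m+1) * D1 e := by
    rw [hD1, ← euler2 m f hf hhom x hx0, ← hD2]
    conv_rhs => rw [← hsum]
    simp
  have s3 : ∑ i, ⟪b i,x⟫^2 = 1 := by
    have := b.sum_sq_norm_inner_right x
    simpa [hx] using this
  rw [s1, s2, s3, lap_eq f x b, ← hD2]
  ring

lemma lap_log {n : ℕ} (hn : 0 < n) (e : En n) 
    (he : ‖e‖ = 1) (r : ℝ) (hr : 0 < r) (b : OrthonormalBasis (Fin n) ℝ (En n))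
    (hb : b ⟨0, hn⟩ = e) :
    ∑ i, fderiv ℝ (fderiv ℝ (fun y : En n => Real.log ‖y‖)) (r • e) (b i) (b i) =
     ((n:ℝ) - 2) * (r^2)⁻¹ := by
  have hre : r • e ≠ 0 := smul_ne_zero hr.ne' (by rintro rfl; simp at he)
  have hC : ContDiffAt ℝ 2 (fun y : En n => Real.log ‖y‖) (r • e) :=
    (contDiffAt_norm ℝ hre).log (norm_ne_zero_iff.2 hre)
  have hterm : ∀ i, fderiv ℝ (fderiv ℝ (fun y : En n => Real.log ‖y‖)) (r • e) (b i) (b i) =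
      (r^2)⁻¹ + if i = ⟨0,hn⟩ then -2 * (r^2)⁻¹ else 0 := by
    intro i
    have h1 := aux_curve (fun y : En n => Real.log ‖y‖) (fun s : ℝ => r • e + s • (b i))
      (fun _ => b i) 0
      (by simpa using hC) (Eventually.of_forall fun s => by
        simpa using ((hasDerivAt_id s).smul_const (b i)).const_add (r • e)) (hasDerivAt_const _ _)
    simp only [zero_smul, add_zero, map_zero] at h1
    rw [← h1]
    set c := ⟪e, b i⟫ with hc
    have hp : ∀ s : ℝ, ‖r • e + s • b i‖^2 = r^2 + 2 * r * c * s + s^2 := by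
      intro s
      have hv : ‖b i‖ = 1 := b.orthonormal.1 i
      rw [← real_inner_self_eq_norm_sq]
      simp only [inner_add_left, inner_add_right, inner_smul_left, inner_smul_right,
        real_inner_self_eq_norm_sq, he, hv, conj_trivial, real_inner_comm e (b i), ← hc]
      ring
    have heq : (fun s : ℝ => Real.log ‖r • e + s • b i‖) =
        fun s => (1/2) * Real.log (r^2 + 2 * r * c * s + s^2) := by
      ext s
      rw [← hp, Real.log_pow]; push_cast; ring
    rw [heq]
    have hder : ∀ s, HasDerivAt (fun s : ℝ => r^2 + 2 * r * c * s + s^2) (2*r*c + 2*s) s := by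
      intro s
      have := (((hasDerivAt_id s).const_mul (2*r*c)).const_add (r^2)).add ((hasDerivAt_id s).pow 2)
      refine this.congr_deriv ?_
      simp
    have hev : ∀ᶠ s in 𝓝 (0:ℝ), r^2 + 2 * r * c * s + s^2 ≠ 0 := by
      refine (hder 0).continuousAt.eventually_ne ?_
      simp [hr.ne']
    have h2 : deriv (fun s => (1/2) * Real.log (r^2 + 2 * r * c * s + s^2)) =ᶠ[𝓝 0]
        fun s => (1/2) * ((2*r*c + 2*s) / (r^2 + 2 * r * c * s + s^2)) := by
      filter_upwards [hev] with s hs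
      exact (((hder s).log hs).const_mul (1/2)).deriv
    rw [h2.deriv_eq]
    have h5 : HasDerivAt (fun s : ℝ => 2*r*c + 2*s) 2 0 := by
      simpa using ((hasDerivAt_id (0:ℝ)).const_mul 2).const_add (2*r*c)
    have h3 := ((h5.div (hder 0) hev.self_of_nhds).const_mul (1/2)).deriv
    refine h3.trans ?_
    have hcc : c^2 = if i = ⟨0,hn⟩ then 1 else 0 := by
      rw [hc, ← hb, orthonormal_iff_ite.1 b.orthonormal]
      by_cases hi : i = ⟨0,hn⟩
      · simp [hi]
      · simp [hi, Ne.symm hi]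
    have : (if i = ⟨0,hn⟩ then -2 * (r^2)⁻¹ else (0:ℝ)) = c^2 * (-2 * (r^2)⁻¹) := by
      rw [hcc]; split_ifs <;> simp
    rw [this]
    field_simp
    ring
  rw [Finset.sum_congr rfl fun i _ => hterm i, Finset.sum_add_distrib]
  simp
  ring

lemma half_int (k : ℕ) (e : En (k+1)) (he : ‖e‖ = 1) (g : En (k+1) → ℝ)
    (hg : IntegrableOn g {ξ : En (k+1) | ‖ξ‖ = 1} μH[(k:ℝ)]) (heven : ∀ z, g (-z) = g z) :
    ∫ ξ in {ξ : En (k+1) | ‖ξ‖ = 1 ∧ 0 < ⟪e, ξ⟫}, g ξ ∂(μH[(k:ℝ)]) =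
      (1/2) * ∫ ξ in {ξ : En (k+1) | ‖ξ‖ = 1}, g ξ ∂(μH[(k:ℝ)]) := by
  have hSm : MeasurableSet {ξ : En (k+1) | ‖ξ‖ = 1} :=
    measurableSet_eq_fun (by fun_prop) (by fun_prop)
  have hHm : MeasurableSet {ξ : En (k+1) | ‖ξ‖ = 1 ∧ 0 < ⟪e, ξ⟫} :=
    hSm.inter (measurableSet_lt (f := fun _ : En (k+1) => (0:ℝ))
      (g := fun ξ : En (k+1) => ⟪e, ξ⟫) (by fun_prop) (by fun_prop))
  set S := {ξ : En (k+1) | ‖ξ‖ = 1} with hS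
  set H := {ξ : En (k+1) | ‖ξ‖ = 1 ∧ 0 < ⟪e, ξ⟫} with hH
  have hHS : H ⊆ S := fun x hx => hx.1
  have h1 := integral_diff hHm hg hHS
  have hne := aux_equator k e he
  let L := LinearIsometryEquiv.neg ℝ (E := En (k+1))
  have h2 := (L.toIsometryEquiv.measurePreserving_hausdorffMeasure (k:ℝ)).setIntegral_preimage_emb
    L.toHomeomorph.measurableEmbedding g H
  have h3 : (S \ H : Set (En (k+1))) =ᵐ[μH[(k:ℝ)]] (L.toIsometryEquiv ⁻¹' H) := by
    rw [ae_restrict_iff' hSm] at hne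
    filter_upwards [hne] with x hx
    apply propext
    change (x ∈ S \ H) ↔ (x ∈ L.toIsometryEquiv ⁻¹' H)
    have hL : L.toIsometryEquiv x = -x := rfl
    simp only [hS, hH, mem_diff, mem_setOf_eq, mem_preimage, hL, norm_neg, inner_neg_right]
    constructor
    · rintro ⟨h, h'⟩
      refine ⟨h, ?_⟩
      have h4 := hx h
      have h5 : ¬ 0 < ⟪e, x⟫ := fun h6 => h' ⟨h, h6⟩
      have := lt_of_le_of_ne (not_lt.1 h5) h4
      linarith
    · rintro ⟨h, h'⟩
      exact ⟨h, fun h6 => by linarith [h6.2]⟩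
  rw [setIntegral_congr_set h3] at h1
  have hL : ∀ x, g (L.toIsometryEquiv x) = g x := fun x => heven x
  simp only [hL] at h2
  rw [h2] at h1
  linarith

lemma main_lap (k m : ℕ) (f : En (k+1) → ℝ) (hf : ∀ z, z ≠ 0 → ContDiffAt ℝ ∞ f z)
    (hhom : ∀ σ : ℝ, ∀ z, f (σ • z) = (σ^(2*m))⁻¹ * f z) (G : En (k+1) → ℝ)
    (hG : ∀ y : En (k+1), G y = ∫ ξ in {ξ : En (k+1) | ‖ξ‖ = 1 ∧ 0 < ⟪y, ξ⟫},
        Real.log ⟪y, ξ⟫ * f ξ ∂(μH[(k:ℝ)])) (y e : En (k+1)) (r : ℝ) (hr : 0 < r)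
    (he : ‖e‖ = 1) (hye : y = r • e) :
    lap (k+1) G y = (1/2 * ∫ ξ in {ξ : En (k+1) | ‖ξ‖ = 1}, f ξ ∂(μH[(k:ℝ)])) *
        ((((k+1:ℕ):ℝ) - 2) * (r^2)⁻¹)
      + (r^2)⁻¹ * ∫ ξ in {ξ : En (k+1) | ‖ξ‖ = 1 ∧ 0 < ⟪y, ξ⟫},
          Real.log ⟪e, ξ⟫ * (((4*m + 4 : ℝ) - ((k+1:ℕ):ℝ)) * ⟪e, ξ⟫ * fderiv ℝ f ξ e + 2 * m * f ξ
       + fderiv ℝ (fderiv ℝ f) ξ e e + ⟪e, ξ⟫^2 * lap (k+1) f ξ) ∂(μH[(k:ℝ)]) := by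
  have he0 : e ≠ 0 := by rintro rfl; simp at he
  have hSm : MeasurableSet {ξ : En (k+1) | ‖ξ‖ = 1} :=
    measurableSet_eq_fun (by fun_prop) (by fun_prop)
  have hHm : MeasurableSet {ξ : En (k+1) | ‖ξ‖ = 1 ∧ 0 < ⟪e, ξ⟫} :=
    hSm.inter (measurableSet_lt (f := fun _ : En (k+1) => (0:ℝ))
      (g := fun ξ : En (k+1) => ⟪e, ξ⟫) (by fun_prop) (by fun_prop))
  have hScomp : IsCompact {ξ : En (k+1) | ‖ξ‖ = 1} := by
    have := isCompact_sphere (0 : En (k+1)) 1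
    have h2 : {ξ : En (k+1) | ‖ξ‖ = 1} = Metric.sphere (0 : En (k+1)) 1 := by
      ext x; simp
    rw [h2]; exact this
  have hHeq : {ξ : En (k+1) | ‖ξ‖ = 1 ∧ 0 < ⟪y, ξ⟫} = {ξ : En (k+1) | ‖ξ‖ = 1 ∧ 0 < ⟪e, ξ⟫} := by
    ext x
    simp only [mem_setOf_eq, hye, inner_smul_left, conj_trivial]
    rw [mul_pos_iff_of_pos_left hr]
  rw [hHeq]
  set S := {ξ : En (k+1) | ‖ξ‖ = 1} with hS
  set H := {ξ : En (k+1) | ‖ξ‖ = 1 ∧ 0 < ⟪e, ξ⟫} with hH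
  have hHS : H ⊆ S := fun x hx => hx.1
  set c := 1/2 * ∫ ξ in S, f ξ ∂(μH[(k:ℝ)]) with hc
  let U : Set (En (k+1)) := {z | z ≠ 0 ∧ wv e z ≠ 0}
  have hU : IsOpen U := by
    have : Continuous fun z => wv e z := by unfold wv; fun_prop
    exact isOpen_ne.inter (isOpen_ne.preimage this)
  have hyU : y ∈ U := by
    refine ⟨by rw [hye]; exact smul_ne_zero hr.ne' he0, ?_⟩
    have : wv e y = (2 * r) • e := by
      rw [hye, wv, norm_smul, he, Real.norm_eq_abs, abs_of_pos hr]; module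
    rw [this]
    exact smul_ne_zero (by positivity) he0
  have hS0 : ∀ ξ ∈ S, ξ ≠ 0 := by
    rintro ξ hξ rfl
    simp [hS] at hξ
  let Φ : En (k+1) → En (k+1) → ℝ := fun z ξ => f (rotL e z ξ)
  have hΦ : ∀ z ∈ U, ∀ ξ ∈ S, ContDiffAt ℝ ∞ (Function.uncurry Φ) (z, ξ) :=
    fun z hz ξ hξ => rotL_smooth e he f hf z ξ hz.1 hz.2 (hS0 ξ hξ)
  let Φ' := fun z ξ => fderiv ℝ (fun z => Φ z ξ) z
  have hΦ' : ∀ z ∈ U, ∀ ξ ∈ S, ContDiffAt ℝ ∞ (Function.uncurry Φ') (z, ξ) :=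
    fun z hz ξ hξ => aux_param_smooth _ _ (hΦ z hz ξ hξ)
  let Φ'' := fun z ξ => fderiv ℝ (fun z => Φ' z ξ) z
  have hΦ'' : ∀ z ∈ U, ∀ ξ ∈ S, ContDiffAt ℝ ∞ (Function.uncurry Φ'') (z, ξ) :=
    fun z hz ξ hξ => aux_param_smooth _ _ (hΦ' z hz ξ hξ)
  let g : En (k+1) → ℝ := fun ξ => Real.log ⟪e, ξ⟫
  have hg : IntegrableOn g H (μH[(k:ℝ)]) := (aux_log k e he).mono_set hHS
  have h1S : IntegrableOn (fun _ : En (k+1) => (1:ℝ)) S (μH[(k:ℝ)]) :=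
    integrableOn_const (aux_sphere_finite k).ne
  have hGU : ∀ z ∈ U, G z = c * Real.log ‖z‖ + ∫ ξ in H, g ξ • Φ z ξ ∂(μH[(k:ℝ)]) := by
    intro z hz
    have mp := (rotL e z).toIsometryEquiv.measurePreserving_hausdorffMeasure (k:ℝ)
    have me := (rotL e z).toHomeomorph.measurableEmbedding
    have e1 := mp.setIntegral_preimage_emb me (fun ξ => Real.log ⟪z, ξ⟫ * f ξ)
      {ξ : En (k+1) | ‖ξ‖ = 1 ∧ 0 < ⟪z, ξ⟫}
    have e2 := mp.setIntegral_preimage_emb me f S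
    have hzn : 0 < ‖z‖ := norm_pos_iff.2 hz.1
    have p1 : (rotL e z).toIsometryEquiv ⁻¹' {ξ : En (k+1) | ‖ξ‖ = 1 ∧ 0 < ⟪z, ξ⟫} = H := by
      ext x
      simp only [mem_preimage, mem_setOf_eq, LinearIsometryEquiv.coe_toIsometryEquiv,
        LinearIsometryEquiv.norm_map, rotL_inner e z he hz.1 hz.2, hH]
      rw [mul_pos_iff_of_pos_left hzn]
    have p2 : (rotL e z).toIsometryEquiv ⁻¹' S = S := by
      ext x
      simp [hS]
    rw [p1] at e1
    rw [p2] at e2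
    simp only [LinearIsometryEquiv.coe_toIsometryEquiv, rotL_inner e z he hz.1 hz.2] at e1 e2
    have i1 : IntegrableOn (fun ξ => f (rotL e z ξ)) S (μH[(k:ℝ)]) := by
      have := (aux_param (μH[(k:ℝ)]) S S hScomp hSm subset_rfl U hU Φ hΦ _ h1S z hz).1 z hz
      unfold IntegrableOn
      simpa [Φ] using this
    have i2 := (aux_param (μH[(k:ℝ)]) S H hScomp hHm hHS U hU Φ hΦ g hg z hz).1 z hz
    have e3 := half_int k e he (fun ξ => f (rotL e z ξ)) i1 (by
      intro x
      have := hhom (-1) (rotL e z x)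
      simpa using this)
    rw [e2, ← hc] at e3
    rw [hG, ← e1, ← e3, mul_comm _ (Real.log ‖z‖), ← integral_const_mul, ← integral_add]
    · refine setIntegral_congr_fun hHm fun ξ hξ => ?_
      simp only [g, Φ, smul_eq_mul]
      rw [Real.log_mul hzn.ne' hξ.2.ne']
      ring
    · exact (i1.mono_set hHS).const_mul _
    · exact i2
  have hlog : ∀ z : En (k+1), z ≠ 0 → ContDiffAt ℝ ∞ (fun z : En (k+1) => Real.log ‖z‖) z :=
    fun z hz => (contDiffAt_norm ℝ hz).log (norm_ne_zero_iff.2 hz)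
  have hD1 : ∀ z ∈ U, fderiv ℝ G z = c • fderiv ℝ (fun z : En (k+1) => Real.log ‖z‖) z +
      ∫ ξ in H, g ξ • Φ' z ξ ∂(μH[(k:ℝ)]) := by
    intro z hz
    have a1 := (((hlog z hz.1).differentiableAt (by simp)).hasFDerivAt.const_mul c).add
      (aux_param (μH[(k:ℝ)]) S H hScomp hHm hHS U hU Φ hΦ g hg z hz).2
    refine (a1.congr_of_eventuallyEq ?_).fderiv
    filter_upwards [hU.mem_nhds hz] with w hw using hGU w hw
  have hD2 : fderiv ℝ (fderiv ℝ G) y =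
      c • fderiv ℝ (fderiv ℝ (fun z : En (k+1) => Real.log ‖z‖)) y +
      ∫ ξ in H, g ξ • Φ'' y ξ ∂(μH[(k:ℝ)]) := by
    have a0 := (((hlog y hyU.1).fderiv_right (m := 1) one_le_inf).differentiableAt
      (by simp)).hasFDerivAt
    have a1 := (a0.const_smul c).add
      (aux_param (μH[(k:ℝ)]) S H hScomp hHm hHS U hU Φ' hΦ' g hg y hyU).2
    refine (a1.congr_of_eventuallyEq ?_).fderiv
    filter_upwards [hU.mem_nhds hyU] with w hw using hD1 w hw
  have i3 := (aux_param (μH[(k:ℝ)]) S H hScomp hHm hHS U hU Φ'' hΦ'' g hg y hyU).1 y hyU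
  obtain ⟨b, hb⟩ := Orthonormal.exists_orthonormalBasis_extension_of_card_eq (𝕜 := ℝ)
    (E := En (k+1)) (ι := Fin (k+1)) (by simp) (v := fun _ => e) (s := {0}) (by
      refine ⟨fun i => by simpa using he, ?_⟩
      rintro ⟨i, hi⟩ ⟨j, hj⟩ hij
      exact absurd (Subtype.ext (hi.trans hj.symm)) hij)
  have hb0 : b ⟨0, Nat.succ_pos k⟩ = e := hb 0 rfl
  rw [lap_eq G y b, hD2]
  have hev : ∀ i, (c • fderiv ℝ (fderiv ℝ (fun z : En (k+1) => Real.log ‖z‖)) y +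
      ∫ ξ in H, g ξ • Φ'' y ξ ∂(μH[(k:ℝ)])) (b i) (b i) =
      c * fderiv ℝ (fderiv ℝ (fun z : En (k+1) => Real.log ‖z‖)) y (b i) (b i) +
      ∫ ξ in H, g ξ * Φ'' y ξ (b i) (b i) ∂(μH[(k:ℝ)]) := by
    intro i
    have j1 := ContinuousLinearMap.integral_apply i3 (b i)
    have i4 := i3.apply_continuousLinearMap (b i)
    have j2 := ContinuousLinearMap.integral_apply i4 (b i)
    rw [_root_.add_apply, _root_.add_apply, j1, j2]
    rfl
  rw [Finset.sum_congr rfl fun i _ => hev i, Finset.sum_add_distrib, ← Finset.mul_sum]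
  congr 1
  · rw [hye, lap_log (Nat.succ_pos k) e he r hr b hb0]
  · rw [← integral_finset_sum, ← integral_const_mul]
    · refine setIntegral_congr_fun hHm fun ξ hξ => ?_
      have := lap_point (Nat.succ_pos k) m f hf hhom ξ e hξ.1 he r hr b hb0
      rw [← hye] at this
      rw [← Finset.mul_sum]
      have h5 : ∑ i, Φ'' y ξ (b i) (b i) = _ := this
      rw [h5]
      simp only [g]
      ring
    · intro i _
      have i4 := i3.apply_continuousLinearMap (b i)
      exact i4.apply_continuousLinearMap (b i)

lemma poly_smooth {n : ℕ} (P : MvPolynomial (Fin n) ℝ) :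
    ContDiff ℝ ∞ (fun ξ : En n => MvPolynomial.eval (fun i => ξ i) P) := by
  induction P using MvPolynomial.induction_on with
  | C a => simpa using contDiff_const
  | add p q hp hq => simpa using hp.add hq
  | mul_X p i hp =>
    have h : ContDiff ℝ ∞ (fun ξ : En n => ξ i) := contDiff_euclidean.1 contDiff_id i
    simpa using hp.mul h

/-- The formula for ΔG in dimension n = 2m+2, where
G(y) = ∫_{⟨y,ξ⟩>0} log(⟨y,ξ⟩)/Q(ξ) dH^{n−1}(ξ). -/
theorem stmt8 (n m : ℕ) (hm : 1 ≤ m) (hn : n = 2*m + 2)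
    (Q : En n → ℝ)
    (hQpoly : ∃ P : MvPolynomial (Fin n) ℝ,
      ∀ ξ : En n, Q ξ = MvPolynomial.eval (fun i => ξ i) P)
    (hQhom : ∀ σ : ℝ, ∀ ξ : En n, Q (σ • ξ) = σ^(2*m) * Q ξ)
    (hQpos : ∀ ξ : En n, ξ ≠ 0 → 0 < Q ξ)
    (G : En n → ℝ)
    (hG : ∀ y : En n, G y =
      ∫ ξ in {ξ : En n | ‖ξ‖ = 1 ∧ 0 < ⟪y, ξ⟫},
        Real.log (⟪y, ξ⟫) / Q ξ ∂μH[(n : ℝ) - 1]) :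
    ∀ y : En n, y ≠ 0 →
      lap n G y =
        ((n : ℝ) - 2)/2 * (1/‖y‖^2) *
            (∫ ξ in {ξ : En n | ‖ξ‖ = 1}, 1 / Q ξ ∂μH[(n : ℝ) - 1])
          + (1/‖y‖^2) *
            ∫ ξ in {ξ : En n | ‖ξ‖ = 1 ∧ 0 < ⟪y, ξ⟫},
              Real.log (⟪ξ, ‖y‖⁻¹ • y⟫) *
                ( ((4*m + 4 : ℝ) - n) * ⟪ξ, ‖y‖⁻¹ • y⟫ *
                    iteratedFDeriv ℝ 1 (fun z => 1 / Q z) ξ (fun _ => ‖y‖⁻¹ • y)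
                  + (2*m : ℝ) / Q ξ
                  + iteratedFDeriv ℝ 2 (fun z => 1 / Q z) ξ (fun _ => ‖y‖⁻¹ • y)
                  + ⟪ξ, ‖y‖⁻¹ • y⟫^2 * lap n (fun z => 1 / Q z) ξ )
              ∂μH[(n : ℝ) - 1] := by
  intro y hy
  obtain ⟨P, hP⟩ := hQpoly
  subst hn
  have hr : 0 < ‖y‖ := norm_pos_iff.2 hy
  have hcast : (((2*m+2 : ℕ) : ℝ) - 1) = ((2*m+1 : ℕ) : ℝ) := by push_cast; ring
  rw [hcast] at hG ⊢
  have hQs : ContDiff ℝ ∞ Q := by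
    have : Q = fun ξ => MvPolynomial.eval (fun i => ξ i) P := funext hP
    rw [this]; exact poly_smooth P
  have hmain := main_lap (2*m+1) m (fun z => 1 / Q z)
    (fun z hz => contDiffAt_const.div hQs.contDiffAt (hQpos z hz).ne')
    (fun σ z => by rw [hQhom, one_div, one_div, mul_inv]) G
    (fun y => by rw [hG y]; simp only [div_eq_mul_inv, one_mul])
    y (‖y‖⁻¹ • y) ‖y‖ hr (by simp [norm_smul, hr.ne']) (by simp [smul_smul, hr.ne'])
  refine hmain.trans ?_
  congr 1
  · simp only [one_div]; push_cast; ring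
  · rw [one_div]
    congr 1
    refine integral_congr_ae (Eventually.of_forall fun ξ => ?_)
    simp only [iteratedFDeriv_two_apply, iteratedFDeriv_one_apply,
      real_inner_comm (‖y‖⁻¹ • y) ξ]
    congr 2
    ring
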